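/- Let N be an odd positive integer, and let n_i, m_i, l_i denote the sequences of odd numbers in the Collatz sequences of n_0 = N, m_0 = 2N + 1, and l_0 = 4N + 3 respectively. Let r be the smallest integer such that n_{r+1} = (3n_r+1)/2^k with k > 1, and let j > 1 be such that m_{r+2} = (3m_{r+1}+1)/2^j. Then l_i = 2m_i + 1 for all i ≤ r + 1, and l_{r+2} = 2^j·m_{r+2} + 1. Moreover, if k > 2, then l_{r+2} = 4m_{r+2} + 1 and l_i = m_i for all i > r + 2. -/

import Mathlib

/-- One step of the Collatz map. -/
def collatzStep (n : ℕ) : ℕ := if Odd n then 3 * n + 1 else n / 2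

/-- For an odd number `a`, the next odd number occurring in the Collatz
sequence of `a`: `(3a+1)/2^v` where `2^v` is the largest power of `2`
dividing `3a+1`. -/
def nextOdd (a : ℕ) : ℕ := (3 * a + 1) / 2 ^ (3 * a + 1).factorization 2

/-- The sequence of odd numbers in the Collatz sequence of an odd number `A`. -/
def oddSeq (A : ℕ) (i : ℕ) : ℕ := nextOdd^[i] A

/-- Two Collatz sequences merge: they become equal after finitely many terms. -/
def collMerges (A B : ℕ) : Prop := ∃ i j, collatzStep^[i] A = collatzStep^[j] B

/-- Two Collatz sequences (of odd starting numbers) are equivalent: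
the second odd number occurring in each sequence is the same. -/
def collEquiv (A B : ℕ) : Prop := nextOdd A = nextOdd B

/-- `A` is a jump from `P` of height `d`:
`A = 4^d * P + 4^(d-1) + ... + 4 + 1`. -/
def isJump (A P d : ℕ) : Prop := 1 ≤ d ∧ A = 4 ^ d * P + (4 ^ d - 1) / 3

theorem odd_nextOdd (a : ℕ) : Odd (nextOdd a) := by
  rw [← Nat.not_even_iff_odd, even_iff_two_dvd]
  exact Nat.not_dvd_ordCompl Nat.prime_two (Nat.succ_ne_zero _)

theorem nextOdd_eq {a b v : ℕ} (hb : Odd b) (h : 3 * a + 1 = 2 ^ v * b) : nextOdd a = b := by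
  have hv : (3 * a + 1).factorization 2 = v := by
    rw [h, Nat.factorization_mul (by positivity) hb.pos.ne', Nat.prime_two.factorization_pow]
    simp [Nat.factorization_eq_zero_of_not_dvd hb.not_two_dvd_nat]
  rw [nextOdd, hv, h, Nat.mul_div_cancel_left _ (by positivity)]

theorem nextOdd_two_mul_add_one {a : ℕ} (ha : Odd a) : nextOdd (2 * a + 1) = 3 * a + 2 := by
  refine nextOdd_eq (v := 1) ?_ (by ring)
  obtain ⟨c, rfl⟩ := ha
  exact ⟨3 * c + 2, by ring⟩

theorem nextOdd_four_mul_add_one (a : ℕ) : nextOdd (4 * a + 1) = nextOdd a := by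
  refine nextOdd_eq (v := (3 * a + 1).factorization 2 + 2) (odd_nextOdd a) ?_
  have h : 2 ^ (3 * a + 1).factorization 2 * nextOdd a = 3 * a + 1 :=
    Nat.ordProj_mul_ordCompl_eq_self (3 * a + 1) 2
  rw [pow_add]
  linarith

theorem oddSeq_succ (A i : ℕ) : oddSeq A (i + 1) = nextOdd (oddSeq A i) :=
  Function.iterate_succ_apply' nextOdd i A

theorem odd_oddSeq {A : ℕ} (hA : Odd A) : ∀ i, Odd (oddSeq A i)
  | 0 => hA
  | i + 1 => oddSeq_succ A i ▸ odd_nextOdd _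

theorem oddSeq_two_mul_add_one {N r : ℕ} (hN : Odd N)
    (h : ∀ i, i < r → 3 * oddSeq N i + 1 = 2 * oddSeq N (i + 1)) :
    ∀ i, i ≤ r → oddSeq (2 * N + 1) i = 2 * oddSeq N i + 1
  | 0, _ => rfl
  | i + 1, hi => by
    rw [oddSeq_succ, oddSeq_two_mul_add_one hN h i (by omega),
      nextOdd_two_mul_add_one (odd_oddSeq hN i)]
    have := h i hi
    omega

theorem stmt5 (N : ℕ) (hN : Odd N) (hNpos : 0 < N) (r k j : ℕ) (hk : 1 < k)
    (hr : 3 * oddSeq N r + 1 = 2 ^ k * oddSeq N (r + 1))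
    (hrmin : ∀ i, i < r → 3 * oddSeq N i + 1 = 2 * oddSeq N (i + 1))
    (hj : 1 < j)
    (hm : 3 * oddSeq (2 * N + 1) (r + 1) + 1 = 2 ^ j * oddSeq (2 * N + 1) (r + 2)) :
    (∀ i, i ≤ r + 1 → oddSeq (4 * N + 3) i = 2 * oddSeq (2 * N + 1) i + 1) ∧
    oddSeq (4 * N + 3) (r + 2) = 2 ^ j * oddSeq (2 * N + 1) (r + 2) + 1 ∧
    (2 < k →
      oddSeq (4 * N + 3) (r + 2) = 4 * oddSeq (2 * N + 1) (r + 2) + 1 ∧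
      ∀ i, r + 2 < i → oddSeq (4 * N + 3) i = oddSeq (2 * N + 1) i) := by
  have hM : Odd (2 * N + 1) := odd_two_mul_add_one N
  have hmn := oddSeq_two_mul_add_one hN hrmin
  have hm_succ : ∀ i, i ≤ r → oddSeq (2 * N + 1) (i + 1) = 3 * oddSeq N i + 2 := fun i hi => by
    rw [oddSeq_succ, hmn i hi, nextOdd_two_mul_add_one (odd_oddSeq hN i)]
  have hlm : ∀ i, i ≤ r + 1 → oddSeq (4 * N + 3) i = 2 * oddSeq (2 * N + 1) i + 1 := by
    have h := oddSeq_two_mul_add_one (r := r + 1) hM fun i hi => by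
      rw [hm_succ i (by omega), hmn i (by omega)]
      ring
    rwa [show 2 * (2 * N + 1) + 1 = 4 * N + 3 by ring] at h
  have hl : oddSeq (4 * N + 3) (r + 2) = 2 ^ j * oddSeq (2 * N + 1) (r + 2) + 1 := by
    rw [oddSeq_succ, hlm (r + 1) le_rfl, nextOdd_two_mul_add_one (odd_oddSeq hM _), ← hm]
  refine ⟨hlm, hl, fun hk2 => ?_⟩
  have hj2 : j = 2 := by
    by_contra hne
    obtain ⟨t, rfl⟩ := Nat.exists_eq_add_of_le (show 3 ≤ j by omega)
    obtain ⟨s, rfl⟩ := Nat.exists_eq_add_of_le (show 3 ≤ k by omega)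
    rw [pow_add, mul_assoc] at hm hr
    have := hm_succ r le_rfl
    omega
  subst hj2
  refine ⟨hl, fun i hi => ?_⟩
  induction i, hi using Nat.le_induction with
  | base => rw [oddSeq_succ, hl, oddSeq_succ (2 * N + 1) (r + 2)]; exact nextOdd_four_mul_add_one _
  | succ i _ ih => rw [oddSeq_succ, ih, ← oddSeq_succ]
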